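/- arXiv:2312.10739 — 2 statements merged into one kernel-verified Lean document; each statement's English description precedes it below -/
import Mathlib

section
/- Let m be a positive natural number, s : Fin m → ℝ with s i ≥ 0 for every i, and k a natural number with 1 ≤ k ≤ m. Then topK(s,k) equals the infimum over all u ∈ ℝ and v : Fin m → ℝ satisfying u ≥ 0, v i ≥ 0 and v i + u ≥ s i for every i, of the quantity k * u + ∑_i v i. That is, when all entries of s are nonnegative, the sign constraint u ≥ 0 can be added to the dual problem without changing its optimal value. -/
/-- The sum of the `k` largest entries of `s`: the maximum over all subsets
`T` of `Fin m` with `|T| = k` of `∑ i ∈ T, s i`. -/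
noncomputable def topK {m : ℕ} (s : Fin m → ℝ) (k : ℕ) : ℝ :=
  sSup {y : ℝ | ∃ T : Finset (Fin m), T.card = k ∧ ∑ i ∈ T, s i = y}

/-- Weak duality: a sum over `T` is bounded by every dual feasible value. -/
theorem sum_le_card_mul_add_sum {ι : Type*} [Fintype ι] {s v : ι → ℝ} {u : ℝ}
    (hv : ∀ i, 0 ≤ v i) (hsv : ∀ i, s i ≤ v i + u) (T : Finset ι) :
    ∑ i ∈ T, s i ≤ (T.card : ℝ) * u + ∑ i, v i := by
  calc ∑ i ∈ T, s i ≤ ∑ i ∈ T, (v i + u) := Finset.sum_le_sum fun i _ => hsv i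
    _ = (T.card : ℝ) * u + ∑ i ∈ T, v i := by
        rw [Finset.sum_add_distrib, Finset.sum_const, nsmul_eq_mul, add_comm]
    _ ≤ (T.card : ℝ) * u + ∑ i, v i := by
        gcongr
        · exact fun i _ _ => hv i
        · exact Finset.subset_univ T

/-- In a set maximizing the sum among sets of its cardinality, every entry dominates every entry
outside the set. -/
theorem le_of_sum_max {ι : Type*} [DecidableEq ι] {s : ι → ℝ} {T : Finset ι}
    (hT : ∀ T' : Finset ι, T'.card = T.card → ∑ i ∈ T', s i ≤ ∑ i ∈ T, s i)
    {i j : ι} (hi : i ∈ T) (hj : j ∉ T) : s j ≤ s i := by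
  have hj' : j ∉ T.erase i := fun h => hj (Finset.mem_of_mem_erase h)
  have h := hT (insert j (T.erase i)) (by
    rw [Finset.card_insert_of_notMem hj', Finset.card_erase_add_one hi])
  rw [Finset.sum_insert hj', ← Finset.add_sum_erase T s hi] at h
  linarith

/-- For nonnegative `s`, the sign constraint `u ≥ 0` can be added to the dual
problem without changing its optimal value. -/
theorem topK_eq_dual_inf_nonneg (m : ℕ) (hm : 0 < m) (s : Fin m → ℝ)
    (hs : ∀ i, 0 ≤ s i) (k : ℕ) (hk1 : 1 ≤ k) (hkm : k ≤ m) :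
    topK s k
      = sInf {y : ℝ | ∃ (u : ℝ) (v : Fin m → ℝ),
          0 ≤ u ∧ (∀ i, 0 ≤ v i) ∧ (∀ i, s i ≤ v i + u) ∧
          (k : ℝ) * u + ∑ i, v i = y} := by
  obtain ⟨T, hTmem, hTmax⟩ := Finset.exists_max_image
    (Finset.powersetCard k (Finset.univ : Finset (Fin m))) (fun T => ∑ i ∈ T, s i)
    (Finset.powersetCard_nonempty.2 (by simpa using hkm))
  have hTk : T.card = k := (Finset.mem_powersetCard.1 hTmem).2
  have hmax : ∀ T' : Finset (Fin m), T'.card = k → ∑ i ∈ T', s i ≤ ∑ i ∈ T, s i :=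
    fun T' h => hTmax T' (Finset.mem_powersetCard.2 ⟨Finset.subset_univ _, h⟩)
  obtain ⟨a, haT, ha⟩ := Finset.exists_min_image T s (Finset.card_pos.1 (by omega))
  have hprimal : IsGreatest {y : ℝ | ∃ T : Finset (Fin m), T.card = k ∧ ∑ i ∈ T, s i = y}
      (∑ i ∈ T, s i) := by
    refine ⟨⟨T, hTk, rfl⟩, ?_⟩
    rintro _ ⟨T', hT', rfl⟩
    exact hmax T' hT'
  have hdual : IsLeast {y : ℝ | ∃ (u : ℝ) (v : Fin m → ℝ),
      0 ≤ u ∧ (∀ i, 0 ≤ v i) ∧ (∀ i, s i ≤ v i + u) ∧ (k : ℝ) * u + ∑ i, v i = y}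
      (∑ i ∈ T, s i) := by
    refine ⟨⟨s a, fun i => max (s i - s a) 0, hs a, fun i => le_max_right _ _, fun i => ?_, ?_⟩, ?_⟩
    · linarith [le_max_left (s i - s a) 0]
    · have hsum : ∑ i, max (s i - s a) 0 = ∑ i ∈ T, (s i - s a) := by
        rw [← Finset.sum_subset (Finset.subset_univ T)]
        · exact Finset.sum_congr rfl fun i hi => max_eq_left (sub_nonneg.2 (ha i hi))
        · intro i _ hi
          exact max_eq_right (sub_nonpos.2 (le_of_sum_max (fun T' h => hmax T' (h.trans hTk)) haT hi))
      rw [hsum, Finset.sum_sub_distrib, Finset.sum_const, nsmul_eq_mul, hTk]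
      ring
    · rintro _ ⟨u, v, _, hv, hsv, rfl⟩
      simpa only [hTk] using sum_le_card_mul_add_sum hv hsv T
  rw [topK, hprimal.csSup_eq, hdual.csInf_eq]
end

section
/- Let n, m be positive natural numbers, k a natural number with k ≤ m, Σ : Matrix (Fin n) (Fin n) ℝ a positive semidefinite matrix, μ : Fin n → ℝ, and s : Fin m → (Fin n → ℝ). Then the objective function F : (Fin n → ℝ) → ℝ of the k-worst Non-ESG portfolio model, F(x) = xᵀ Σ x − ∑_j μ j * x j + topK((fun i => ∑_j s i j * x j), k), is convex on all of ℝⁿ. -/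
/-- The sum over any `k`-element subset is at most `topK s k`. -/
lemma sum_le_topK {m : ℕ} (s : Fin m → ℝ) (T : Finset (Fin m)) :
    ∑ i ∈ T, s i ≤ topK s T.card := by
  have hfin : {y : ℝ | ∃ U : Finset (Fin m), U.card = T.card ∧ ∑ i ∈ U, s i = y}.Finite :=
    (Set.finite_range fun U : Finset (Fin m) => ∑ i ∈ U, s i).subset
      fun _ ⟨U, _, hU⟩ => ⟨U, hU⟩
  exact le_csSup hfin.bddAbove ⟨T, rfl, rfl⟩

/-- An upper bound of all sums over `k`-element subsets bounds `topK s k`, if `k ≤ m`. -/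
lemma topK_le {m k : ℕ} (hk : k ≤ m) {s : Fin m → ℝ} {b : ℝ}
    (h : ∀ T : Finset (Fin m), T.card = k → ∑ i ∈ T, s i ≤ b) : topK s k ≤ b := by
  obtain ⟨T, -, hT⟩ := Finset.exists_subset_card_eq
    (s := (Finset.univ : Finset (Fin m))) (n := k) (by simpa using hk)
  refine csSup_le ⟨_, T, hT, rfl⟩ ?_
  rintro _ ⟨U, hU, rfl⟩
  exact h U hU

/-- `topK` is convex. -/
lemma topK_convex_combination_le {m k : ℕ} (hk : k ≤ m) (u v : Fin m → ℝ) {a b : ℝ}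
    (ha : 0 ≤ a) (hb : 0 ≤ b) :
    topK (fun i => a * u i + b * v i) k ≤ a * topK u k + b * topK v k := by
  refine topK_le hk ?_
  rintro T rfl
  rw [Finset.sum_add_distrib, ← Finset.mul_sum, ← Finset.mul_sum]
  gcongr <;> exact sum_le_topK _ T

/-- The defect of convexity of a quadratic form along a segment. -/
lemma quadratic_form_convex_combination {ι : Type*} [Fintype ι] (A : Matrix ι ι ℝ)
    (x y : ι → ℝ) (t : ℝ) :
    ∑ j, ∑ l, (t • x + (1 - t) • y) j * A j l * (t • x + (1 - t) • y) l
      = t * (∑ j, ∑ l, x j * A j l * x l) + (1 - t) * (∑ j, ∑ l, y j * A j l * y l)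
        - t * (1 - t) * ∑ j, ∑ l, (x - y) j * A j l * (x - y) l := by
  simp only [Finset.mul_sum, ← Finset.sum_add_distrib, ← Finset.sum_sub_distrib]
  refine Finset.sum_congr rfl fun j _ => Finset.sum_congr rfl fun l _ => ?_
  simp only [Pi.add_apply, Pi.sub_apply, Pi.smul_apply, smul_eq_mul]
  ring

/-- A linear functional preserves convex combinations. -/
lemma sum_mul_convex_combination {ι : Type*} [Fintype ι] (c x y : ι → ℝ) (t : ℝ) :
    ∑ j, c j * (t • x + (1 - t) • y) j
      = t * (∑ j, c j * x j) + (1 - t) * ∑ j, c j * y j := by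
  simp only [Finset.mul_sum, ← Finset.sum_add_distrib]
  refine Finset.sum_congr rfl fun j _ => ?_
  simp only [Pi.add_apply, Pi.smul_apply, smul_eq_mul]
  ring


/-- With `Σ` positive semidefinite, the objective of the `k`-worst Non-ESG
portfolio model, `F(x) = xᵀΣx − ⟨μ, x⟩ + topK(⟨s i, x⟩, k)`, is convex on all
of `ℝⁿ`. -/
theorem portfolio_objective_convex (n m : ℕ) (hn : 0 < n) (hm : 0 < m)
    (k : ℕ) (hk : k ≤ m) (Sig : Matrix (Fin n) (Fin n) ℝ)
    (hSymm : Sig.IsSymm) (hPSD : ∀ x : Fin n → ℝ, 0 ≤ ∑ j, ∑ l, x j * Sig j l * x l)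
    (μ : Fin n → ℝ) (s : Fin m → Fin n → ℝ) :
    ∀ (x y : Fin n → ℝ) (t : ℝ), 0 ≤ t → t ≤ 1 →
      ((∑ j, ∑ l, (t • x + (1 - t) • y) j * Sig j l * (t • x + (1 - t) • y) l)
        - (∑ j, μ j * (t • x + (1 - t) • y) j)
        + topK (fun i => ∑ j, s i j * (t • x + (1 - t) • y) j) k)
      ≤ t * ((∑ j, ∑ l, x j * Sig j l * x l) - (∑ j, μ j * x j)
            + topK (fun i => ∑ j, s i j * x j) k)
        + (1 - t) * ((∑ j, ∑ l, y j * Sig j l * y l) - (∑ j, μ j * y j)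
            + topK (fun i => ∑ j, s i j * y j) k) := by
  intro x y t ht0 ht1
  have ht1' : 0 ≤ 1 - t := sub_nonneg.mpr ht1
  have htop := topK_convex_combination_le hk
    (fun i => ∑ j, s i j * x j) (fun i => ∑ j, s i j * y j) ht0 ht1'
  have hquad := mul_nonneg (mul_nonneg ht0 ht1') (hPSD (x - y))
  rw [quadratic_form_convex_combination]
  simp only [sum_mul_convex_combination]
  linarith
end
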